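/- Let c' < c'' < c be real numbers. Let G : ℂ → ℂ be analytic on {w : Re(w) > c'} and suppose there exist constants C, B > 0 such that |G(σ + it)| ≤ C (1 + |t|)^B for all σ ∈ [c'', c] and all t ∈ ℝ. Let w_1, …, w_m be distinct complex numbers with c'' < Re(w_j) < c for all j, let r_1, …, r_m ∈ ℂ, and set F(w) = G(w) + Σ_{j=1}^m r_j/(w − w_j). Let g : ℝ → ℂ be smooth with compact support contained in (0, ∞), with Mellin transform g̃(s) = ∫_0^∞ g(x) x^{s−1} dx. Then there exists a constant C₁ (depending on G, g, c, c'', the w_j and r_j, but not on X) such that for all X ≥ 1, the integral (1/(2π)) ∫_{−∞}^{∞} F(c + it) g̃(c + it) X^{c+it} dt converges absolutely and equals Σ_{j=1}^m r_j g̃(w_j) X^{w_j} + E(X) with |E(X)| ≤ C₁ X^{c''}. -/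

import Mathlib

open Complex MeasureTheory
open Set Filter Topology
open scoped ContDiff

/-- Smooth functions with compact support contained in `(0, ∞)`. -/
structure IsMellinTest (g : ℝ → ℂ) : Prop where
  contDiff : ContDiff ℝ ∞ g
  hasCompactSupport : HasCompactSupport g
  tsupport_subset : tsupport g ⊆ Ioi 0

namespace IsMellinTest

variable {g : ℝ → ℂ}

theorem zero_notMem_tsupport (hg : IsMellinTest g) : (0 : ℝ) ∉ tsupport g :=
  fun h => lt_irrefl (0 : ℝ) (hg.tsupport_subset h)

theorem contDiff_cpow_mul (hg : IsMellinTest g) (s : ℂ) :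
    ContDiff ℝ ∞ (fun x : ℝ => (x : ℂ) ^ s * g x) := by
  refine contDiff_iff_contDiffAt.2 fun x => ?_
  by_cases hx : x ∈ tsupport g
  swap
  · refine (contDiffAt_const (c := (0 : ℂ))).congr_of_eventuallyEq ?_
    filter_upwards [notMem_tsupport_iff_eventuallyEq.1 hx] with y hy
    simp [hy]
  have hx0 : 0 < x := hg.tsupport_subset hx
  refine ContDiffAt.mul ?_ hg.contDiff.contDiffAt
  have h : ContDiffAt ℝ ∞ (fun y : ℝ => cexp (((Real.log y : ℝ) : ℂ) * s)) x := by
    have hlog : ContDiffAt ℝ ∞ (fun y : ℝ => Real.log y) x := contDiffAt_id.log hx0.ne'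
    exact ((ofRealCLM.contDiff.contDiffAt.comp x hlog).mul contDiffAt_const).cexp
  refine h.congr_of_eventuallyEq ?_
  filter_upwards [lt_mem_nhds hx0] with y hy
  rw [cpow_def_of_ne_zero (ofReal_ne_zero.2 hy.ne'), ofReal_log hy.le]

theorem hasCompactSupport_cpow_mul (hg : IsMellinTest g) (s : ℂ) :
    HasCompactSupport (fun x : ℝ => (x : ℂ) ^ s * g x) :=
  hg.hasCompactSupport.mul_left

theorem mellinConvergent (hg : IsMellinTest g) (s : ℂ) : MellinConvergent g s :=
  ((hg.contDiff_cpow_mul (s - 1)).continuous.integrable_of_hasCompactSupport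
    (hg.hasCompactSupport_cpow_mul (s - 1))).integrableOn

theorem neg_mul_deriv (hg : IsMellinTest g) :
    IsMellinTest (fun x : ℝ => -((x : ℂ) * deriv g x)) where
  contDiff := (ofRealCLM.contDiff.mul (hg.contDiff.iterate_deriv 1)).neg
  hasCompactSupport := by
    simpa only [Pi.mul_def, neg_mul] using
      hg.hasCompactSupport.deriv.mul_left (f := fun x : ℝ => -(x : ℂ))
  tsupport_subset := by
    refine Subset.trans ?_ (tsupport_deriv_subset.trans hg.tsupport_subset)
    refine closure_mono fun x hx => ?_
    simp only [Function.mem_support] at hx ⊢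
    contrapose! hx
    simp [hx]

theorem mellin_neg_mul_deriv (hg : IsMellinTest g) (s : ℂ) :
    mellin (fun x : ℝ => -((x : ℂ) * deriv g x)) s = s * mellin g s := by
  have h0 : ∫ x in Ioi (0 : ℝ), deriv (fun x : ℝ => (x : ℂ) ^ s * g x) x = 0 := by
    rw [(hg.hasCompactSupport_cpow_mul s).integral_Ioi_deriv_eq
      ((hg.contDiff_cpow_mul s).of_le (by simp)) 0,
      image_eq_zero_of_notMem_tsupport hg.zero_notMem_tsupport]
    simp
  have h1 : ∫ x in Ioi (0 : ℝ), deriv (fun x : ℝ => (x : ℂ) ^ s * g x) x =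
      ∫ x in Ioi (0 : ℝ), (s • ((x : ℂ) ^ (s - 1) • g x) -
        (x : ℂ) ^ (s - 1) • (-((x : ℂ) * deriv g x))) := by
    refine setIntegral_congr_fun measurableSet_Ioi fun x hx => ?_
    have hx' : (x : ℂ) ≠ 0 := ofReal_ne_zero.2 (ne_of_gt hx)
    have hd := ((hasStrictDerivAt_cpow_const (c := s)
      (ofReal_mem_slitPlane.2 hx)).hasDerivAt.comp_ofReal).fun_mul
      ((hg.contDiff.differentiable (by simp)) x).hasDerivAt
    simp only [hd.deriv, smul_eq_mul, cpow_sub _ _ hx', cpow_one]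
    field_simp
    ring
  have hi : IntegrableOn (fun x : ℝ => s • ((x : ℂ) ^ (s - 1) • g x)) (Ioi 0) :=
    (hg.mellinConvergent s).smul s
  rw [h1, integral_sub hi (hg.neg_mul_deriv.mellinConvergent s), integral_smul,
    sub_eq_zero] at h0
  exact h0.symm

theorem differentiable_mellin (hg : IsMellinTest g) : Differentiable ℂ (mellin g) := fun s => by
  refine mellin_differentiableAt_of_isBigO_rpow (a := s.re + 1) (b := s.re - 1)
    (hg.contDiff.continuous.locallyIntegrable.locallyIntegrableOn _) ?_ (by simp) ?_ (by simp)
  · have h : g =ᶠ[atTop] 0 := by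
      have := hasCompactSupport_iff_eventuallyEq.1 hg.hasCompactSupport
      rw [coclosedCompact_eq_cocompact] at this
      exact this.filter_mono atTop_le_cocompact
    exact h.trans_isBigO (Asymptotics.isBigO_zero _ _)
  · have h : g =ᶠ[𝓝[>] 0] 0 := (notMem_tsupport_iff_eventuallyEq.1
      hg.zero_notMem_tsupport).filter_mono nhdsWithin_le_nhds
    exact h.trans_isBigO (Asymptotics.isBigO_zero _ _)

theorem exists_norm_mellin_le (hg : IsMellinTest g) (a b : ℝ) :
    ∃ K : ℝ, ∀ s : ℂ, s.re ∈ Icc a b → ‖mellin g s‖ ≤ K := by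
  have hi (σ : ℝ) : IntegrableOn (fun x : ℝ => x ^ (σ - 1) * ‖g x‖) (Ioi 0) := by
    refine IntegrableOn.congr_fun (hg.mellinConvergent σ).norm (fun x hx => ?_) measurableSet_Ioi
    simp only [norm_smul, norm_cpow_eq_rpow_re_of_pos hx]
    simp
  refine ⟨∫ x in Ioi (0 : ℝ), (x ^ (a - 1) * ‖g x‖ + x ^ (b - 1) * ‖g x‖), fun s hs => ?_⟩
  refine norm_integral_le_of_norm_le ((hi a).add (hi b)) ?_
  refine (ae_restrict_iff' measurableSet_Ioi).2 (ae_of_all _ fun x hx => ?_)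
  have hx0 : 0 < x := hx
  rw [norm_smul, norm_cpow_eq_rpow_re_of_pos hx0, ← add_mul]
  refine mul_le_mul_of_nonneg_right ?_ (norm_nonneg _)
  have ha := Real.rpow_nonneg hx0.le (a - 1)
  have hb := Real.rpow_nonneg hx0.le (b - 1)
  simp only [sub_re, one_re]
  rcases le_total x 1 with h | h
  · linarith [Real.rpow_le_rpow_of_exponent_ge hx0 h (sub_le_sub_right hs.1 1)]
  · linarith [Real.rpow_le_rpow_of_exponent_le h (sub_le_sub_right hs.2 1)]

theorem exists_norm_pow_mul_mellin_le (hg : IsMellinTest g) (a b : ℝ) (N : ℕ) :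
    ∃ K : ℝ, ∀ s : ℂ, s.re ∈ Icc a b → ‖s‖ ^ N * ‖mellin g s‖ ≤ K := by
  induction N generalizing g with
  | zero => simpa using hg.exists_norm_mellin_le a b
  | succ N ih =>
    obtain ⟨K, hK⟩ := ih hg.neg_mul_deriv
    refine ⟨K, fun s hs => ?_⟩
    have := hK s hs
    rwa [hg.mellin_neg_mul_deriv, norm_mul, ← mul_assoc, ← pow_succ] at this

/-- The Mellin transform of a test function decays faster than any polynomial in vertical strips. -/
theorem exists_one_add_abs_im_pow_mul_norm_mellin_le (hg : IsMellinTest g) (a b : ℝ) (N : ℕ) :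
    ∃ K : ℝ, ∀ s : ℂ, s.re ∈ Icc a b → (1 + |s.im|) ^ N * ‖mellin g s‖ ≤ K := by
  obtain ⟨K₀, h₀⟩ := hg.exists_norm_mellin_le a b
  obtain ⟨K, hK⟩ := hg.exists_norm_pow_mul_mellin_le a b N
  refine ⟨2 ^ (N - 1) * (K₀ + K), fun s hs => ?_⟩
  calc (1 + |s.im|) ^ N * ‖mellin g s‖
      ≤ 2 ^ (N - 1) * (1 ^ N + |s.im| ^ N) * ‖mellin g s‖ := by
        gcongr; exact add_pow_le zero_le_one (abs_nonneg _) N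
    _ ≤ 2 ^ (N - 1) * (1 ^ N + ‖s‖ ^ N) * ‖mellin g s‖ := by
        gcongr; exact abs_im_le_norm s
    _ = 2 ^ (N - 1) * (‖mellin g s‖ + ‖s‖ ^ N * ‖mellin g s‖) := by ring
    _ ≤ _ := by gcongr; exacts [h₀ s hs, hK s hs]

end IsMellinTest

/-- Shifting the line of integration of a holomorphic function with quadratic decay in a strip. -/
theorem integral_vertical_line_eq_of_norm_le {H : ℂ → ℂ} {a b K : ℝ} (hab : a ≤ b)
    (hH : DifferentiableOn ℂ H (re ⁻¹' Icc a b))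
    (hK : ∀ σ ∈ Icc a b, ∀ t : ℝ, ‖H (σ + t * I)‖ ≤ K * (1 + t ^ 2)⁻¹) :
    ∫ t : ℝ, H (b + t * I) = ∫ t : ℝ, H (a + t * I) := by
  have hint (σ : ℝ) (hσ : σ ∈ Icc a b) : Integrable fun t : ℝ => H (σ + t * I) := by
    refine (integrable_inv_one_add_sq.const_mul K).mono' ?_ (ae_of_all _ (hK σ hσ))
    refine Continuous.aestronglyMeasurable ?_
    exact hH.continuousOn.comp_continuous (by fun_prop) fun t => by simpa using hσ
  have hlim (σ : ℝ) (hσ : σ ∈ Icc a b) :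
      Tendsto (fun T : ℝ => ∫ t in (-T)..T, H (σ + t * I)) atTop (𝓝 (∫ t : ℝ, H (σ + t * I))) :=
    intervalIntegral_tendsto_integral (hint σ hσ) tendsto_neg_atTop_atBot tendsto_id
  have hhor (T : ℝ) : ‖∫ x in a..b, H (x + T * I)‖ ≤ K * (1 + T ^ 2)⁻¹ * |b - a| := by
    refine intervalIntegral.norm_integral_le_of_norm_le_const fun x hx => hK x ?_ T
    rw [uIoc_of_le hab] at hx
    exact Ioc_subset_Icc_self hx
  have hdecay : Tendsto (fun T : ℝ => K * (1 + T ^ 2)⁻¹ * |b - a|) atTop (𝓝 0) := by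
    have : Tendsto (fun T : ℝ => (1 + T ^ 2)⁻¹) atTop (𝓝 0) :=
      (tendsto_atTop_add_const_left _ _ (tendsto_pow_atTop two_ne_zero)).inv_tendsto_atTop
    simpa using (this.const_mul K).mul_const |b - a|
  have htop : Tendsto (fun T : ℝ => ∫ x in a..b, H (x + T * I)) atTop (𝓝 0) :=
    squeeze_zero_norm hhor hdecay
  have hbot : Tendsto (fun T : ℝ => ∫ x in a..b, H (x + (-T : ℝ) * I)) atTop (𝓝 0) :=
    squeeze_zero_norm (fun T => by simpa using hhor (-T)) hdecay
  have hrect (T : ℝ) : (∫ x in a..b, H (x + (-T : ℝ) * I)) - (∫ x in a..b, H (x + T * I)) +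
      I * (∫ t in (-T)..T, H (b + t * I)) - I * (∫ t in (-T)..T, H (a + t * I)) = 0 := by
    have := integral_boundary_rect_eq_zero_of_differentiableOn H ⟨a, -T⟩ ⟨b, T⟩
      (hH.mono fun z hz => by simpa [uIcc_of_le hab] using hz.1)
    simpa using this
  have hlim0 := ((hbot.sub htop).add ((hlim b (right_mem_Icc.2 hab)).const_mul I)).sub
    ((hlim a (left_mem_Icc.2 hab)).const_mul I)
  simp only [hrect] at hlim0
  have h := tendsto_nhds_unique hlim0 tendsto_const_nhds
  rw [sub_zero, zero_add, ← mul_sub] at h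
  exact sub_eq_zero.1 ((mul_eq_zero.1 h).resolve_left I_ne_zero)

theorem norm_ofReal_cpow_line {X : ℝ} (hX : 0 < X) (σ t : ℝ) :
    ‖(X : ℂ) ^ ((σ : ℂ) + t * I)‖ = X ^ σ := by
  rw [norm_cpow_eq_rpow_re_of_pos hX]; simp

theorem integral_Ioc_cpow_sub_one {u : ℂ} (hu : 0 < u.re) :
    ∫ y in Ioc (0 : ℝ) 1, (y : ℂ) ^ (u - 1) = u⁻¹ := by
  have hu0 : u ≠ 0 := fun h => by simp [h] at hu
  rw [← intervalIntegral.integral_of_le zero_le_one, integral_cpow (Or.inl (by simpa using hu))]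
  simp [hu0]

namespace IsMellinTest

variable {g : ℝ → ℂ}

theorem exists_norm_mul_mellin_le (hg : IsMellinTest g) {a b C B : ℝ} (hC : 0 ≤ C) {G : ℂ → ℂ}
    (hG : ∀ σ ∈ Icc a b, ∀ t : ℝ, ‖G (σ + t * I)‖ ≤ C * (1 + |t|) ^ B) :
    ∃ K : ℝ, ∀ σ ∈ Icc a b, ∀ t : ℝ,
      ‖G (σ + t * I) * mellin g (σ + t * I)‖ ≤ K * (1 + t ^ 2)⁻¹ := by
  obtain ⟨n, hn⟩ := exists_nat_ge B
  obtain ⟨K, hK⟩ := hg.exists_one_add_abs_im_pow_mul_norm_mellin_le a b (n + 2)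
  refine ⟨C * K, fun σ hσ t => ?_⟩
  have h := hK (σ + t * I) (by simpa using hσ)
  simp only [add_im, ofReal_im, mul_im, ofReal_re, I_im, mul_one, I_re, mul_zero, add_zero,
    zero_add] at h
  have h1 : 1 ≤ 1 + |t| := by linarith [abs_nonneg t]
  have h2 : (1 + |t|) ^ B ≤ (1 + |t|) ^ n := by
    rw [← Real.rpow_natCast]; exact Real.rpow_le_rpow_of_exponent_le h1 hn
  have h3 : 1 + t ^ 2 ≤ (1 + |t|) ^ 2 := by nlinarith [abs_nonneg t, sq_abs t]
  rw [← div_eq_mul_inv, le_div_iff₀ (by positivity), norm_mul]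
  calc ‖G (σ + t * I)‖ * ‖mellin g (σ + t * I)‖ * (1 + t ^ 2)
      ≤ (C * (1 + |t|) ^ n) * ‖mellin g (σ + t * I)‖ * (1 + |t|) ^ 2 := by
        gcongr; exact (hG σ hσ t).trans (by gcongr)
    _ = C * ((1 + |t|) ^ (n + 2) * ‖mellin g (σ + t * I)‖) := by ring
    _ ≤ C * K := by gcongr

theorem continuous_mellin_line (hg : IsMellinTest g) (σ : ℝ) :
    Continuous fun t : ℝ => mellin g (σ + t * I) :=
  hg.differentiable_mellin.continuous.comp (by fun_prop)

theorem integrable_mul_mellin_mul_cpow (hg : IsMellinTest g) {G : ℂ → ℂ} {σ C B X : ℝ} (hX : 0 < X)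
    (hC : 0 ≤ C) (hGc : Continuous fun t : ℝ => G (σ + t * I))
    (hG : ∀ t : ℝ, ‖G (σ + t * I)‖ ≤ C * (1 + |t|) ^ B) :
    Integrable fun t : ℝ => G (σ + t * I) * mellin g (σ + t * I) * (X : ℂ) ^ ((σ : ℂ) + t * I) := by
  obtain ⟨K, hK⟩ := hg.exists_norm_mul_mellin_le (a := σ) (b := σ) hC (G := G) (B := B)
    fun s hs t => by
      obtain rfl : s = σ := by simpa using hs
      exact hG t
  have hXc : Continuous fun t : ℝ => (X : ℂ) ^ ((σ : ℂ) + t * I) :=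
    Continuous.const_cpow (by fun_prop) (Or.inl (ofReal_ne_zero.2 hX.ne'))
  refine ((integrable_inv_one_add_sq.const_mul K).mul_const (X ^ σ)).mono'
    ((hGc.mul (hg.continuous_mellin_line σ)).mul hXc).aestronglyMeasurable
    (ae_of_all _ fun t => ?_)
  rw [norm_mul, norm_ofReal_cpow_line hX]
  gcongr
  exact hK σ (by simp) t

theorem verticalIntegrable_mellin (hg : IsMellinTest g) (σ : ℝ) :
    VerticalIntegrable (mellin g) σ := by
  simpa [VerticalIntegrable] using hg.integrable_mul_mellin_mul_cpow (G := fun _ => 1) (σ := σ)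
    (C := 1) (B := 0) one_pos zero_le_one continuous_const (by simp)

/-- Mellin inversion, in the form of an integral against `Y ^ s`. -/
theorem integral_mellin_mul_cpow (hg : IsMellinTest g) (σ : ℝ) {Y : ℝ} (hY : 0 < Y) :
    ∫ t : ℝ, mellin g (σ + t * I) * (Y : ℂ) ^ ((σ : ℂ) + t * I) = 2 * Real.pi * g Y⁻¹ := by
  have h := mellinInv_mellin_eq σ g (inv_pos.2 hY) (hg.mellinConvergent σ)
    (hg.verticalIntegrable_mellin σ) hg.contDiff.continuous.continuousAt
  rw [← h, mellinInv]
  have hpi : (2 * Real.pi : ℂ) ≠ 0 := by simp [Real.pi_ne_zero]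
  rw [← coe_smul, smul_eq_mul, ← mul_assoc]
  push_cast
  rw [mul_one_div_cancel hpi, one_mul]
  congr 1 with t
  rw [inv_cpow _ _ (by simp [arg_ofReal_of_nonneg hY.le, Real.pi_ne_zero.symm]), ← cpow_neg,
    neg_neg, smul_eq_mul, mul_comm]

/-- The contribution of a simple pole to the left of the line of integration. -/
theorem integral_div_sub_mul_mellin_mul_cpow (hg : IsMellinTest g) {σ X : ℝ} {w : ℂ}
    (hw : w.re < σ) (hX : 0 < X) :
    ∫ t : ℝ, 1 / ((σ : ℂ) + t * I - w) * mellin g (σ + t * I) * (X : ℂ) ^ ((σ : ℂ) + t * I) =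
      2 * Real.pi * ∫ y in Ioc (0 : ℝ) 1, (y : ℂ) ^ (-w - 1) * g (X * y)⁻¹ := by
  let f : ℝ → ℝ → ℂ := fun t y =>
    (y : ℂ) ^ (t * I) * ((mellin g (σ + t * I) * (X : ℂ) ^ ((σ : ℂ) + t * I)) *
      (y : ℂ) ^ (σ - w - 1))
  have hf : Integrable (Function.uncurry f) (volume.prod (volume.restrict (Ioc (0 : ℝ) 1))) := by
    have h1 : Integrable fun t : ℝ => mellin g (σ + t * I) * (X : ℂ) ^ ((σ : ℂ) + t * I) := by
      simpa using hg.integrable_mul_mellin_mul_cpow (G := fun _ => 1) (σ := σ)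
        (C := 1) (B := 0) hX zero_le_one continuous_const (by simp)
    have h2 : IntegrableOn (fun y : ℝ => (y : ℂ) ^ (σ - w - 1)) (Ioc 0 1) := by
      rw [← intervalIntegrable_iff_integrableOn_Ioc_of_le zero_le_one]
      exact intervalIntegral.intervalIntegrable_cpow' (by simpa using hw)
    refine (h1.mul_prod h2).bdd_mul (c := 1) ?_ ?_
    · exact Measurable.aestronglyMeasurable (by fun_prop)
    · have hmem : ∀ᵐ p ∂(volume.prod (volume.restrict (Ioc (0 : ℝ) 1))), (p : ℝ × ℝ).2 ∈ Ioc 0 1 :=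
        Measure.quasiMeasurePreserving_snd.ae (ae_restrict_mem measurableSet_Ioc)
      filter_upwards [hmem] with p hp
      rw [norm_cpow_eq_rpow_re_of_pos hp.1]
      simp
  have hleft (t : ℝ) : ∫ y in Ioc (0 : ℝ) 1, f t y =
      1 / ((σ : ℂ) + t * I - w) * mellin g (σ + t * I) * (X : ℂ) ^ ((σ : ℂ) + t * I) := by
    have hu : 0 < ((σ : ℂ) + t * I - w).re := by simpa using hw
    rw [one_div, ← integral_Ioc_cpow_sub_one hu, mul_assoc, mul_comm, ← integral_const_mul]
    refine setIntegral_congr_fun measurableSet_Ioc fun y hy => ?_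
    have hy0 : (y : ℂ) ≠ 0 := ofReal_ne_zero.2 hy.1.ne'
    simp only [f]
    rw [show (σ : ℂ) + t * I - w - 1 = t * I + (σ - w - 1) by ring, cpow_add _ _ hy0]
    ring
  have hright (y : ℝ) (hy : y ∈ Ioc (0 : ℝ) 1) :
      ∫ t : ℝ, f t y = 2 * Real.pi * ((y : ℂ) ^ (-w - 1) * g (X * y)⁻¹) := by
    have hy0 : (y : ℂ) ≠ 0 := ofReal_ne_zero.2 hy.1.ne'
    rw [mul_left_comm, ← hg.integral_mellin_mul_cpow σ (mul_pos hX hy.1), ← integral_const_mul]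
    congr 1 with t
    simp only [f]
    rw [ofReal_mul, mul_cpow_ofReal_nonneg hX.le hy.1.le, cpow_add (σ : ℂ) (t * I) hy0,
      show (σ : ℂ) - w - 1 = σ + (-w - 1) by ring, cpow_add _ _ hy0]
    ring
  rw [← integral_const_mul, ← setIntegral_congr_fun measurableSet_Ioc hright,
    ← integral_integral_swap hf]
  exact integral_congr_ae (ae_of_all _ fun t => (hleft t).symm)

theorem exists_norm_le_mul_rpow_neg (hg : IsMellinTest g) (a : ℝ) :
    ∃ K : ℝ, ∀ x : ℝ, 0 < x → ‖g x‖ ≤ K * x ^ (-a) := by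
  obtain ⟨K, hK⟩ := (hg.hasCompactSupport_cpow_mul a).exists_bound_of_continuous
    (hg.contDiff_cpow_mul a).continuous
  refine ⟨K, fun x hx => ?_⟩
  have h := hK x
  rw [norm_mul, norm_cpow_eq_rpow_re_of_pos hx, ofReal_re] at h
  rw [Real.rpow_neg hx.le, ← div_eq_mul_inv, le_div_iff₀ (by positivity), mul_comm]
  exact h

/-- Each simple pole between `a` and the line of integration contributes its residue, up to an error
of size `X ^ a`. -/
theorem exists_norm_integral_div_sub_sub_le (hg : IsMellinTest g) {a σ : ℝ} {w : ℂ}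
    (haw : a < w.re) (hw : w.re < σ) :
    ∃ K : ℝ, ∀ X : ℝ, 0 < X →
      ‖(1 / (2 * (Real.pi : ℂ))) * (∫ t : ℝ, 1 / ((σ : ℂ) + t * I - w) * mellin g (σ + t * I) *
        (X : ℂ) ^ ((σ : ℂ) + t * I)) - mellin g w * (X : ℂ) ^ w‖ ≤ K * X ^ a := by
  obtain ⟨K, hK⟩ := hg.exists_norm_le_mul_rpow_neg a
  refine ⟨K * ∫ y in Ioi (1 : ℝ), y ^ (a - w.re - 1), fun X hX => ?_⟩
  have hpi : (2 * Real.pi : ℂ) ≠ 0 := by simp [Real.pi_ne_zero]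
  set φ : ℝ → ℂ := fun y => (y : ℂ) ^ (-w - 1) * g (X * y)⁻¹ with hφ
  have hmain : ∫ y in Ioi (0 : ℝ), φ y = mellin g w * (X : ℂ) ^ w := by
    have h := mellin_comp_mul_left (fun x => g x⁻¹) (-w) hX
    rw [mellin_comp_inv, neg_neg, smul_eq_mul, mul_comm] at h
    exact h
  have hconv : IntegrableOn φ (Ioi 0) := by
    have h1 : MellinConvergent (fun x => g x⁻¹) (-w) := by
      have := (MellinConvergent.comp_rpow (f := g) (s := -w) (a := -1) (by norm_num)).2
        (by simpa using hg.mellinConvergent w)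
      simpa [Real.rpow_neg_one] using this
    exact (MellinConvergent.comp_mul_left hX).2 h1
  have hsplit : ∫ y in Ioi (0 : ℝ), φ y = (∫ y in Ioc (0 : ℝ) 1, φ y) + ∫ y in Ioi (1 : ℝ), φ y := by
    rw [← Ioc_union_Ioi_eq_Ioi (zero_le_one (α := ℝ))] at hconv ⊢
    exact setIntegral_union (Ioc_disjoint_Ioi le_rfl) measurableSet_Ioi
      hconv.left_of_union hconv.right_of_union
  rw [hg.integral_div_sub_mul_mellin_mul_cpow hw hX, ← mul_assoc, one_div_mul_cancel hpi, one_mul,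
    ← hmain, hsplit, sub_add_cancel_left, norm_neg, mul_right_comm, ← integral_const_mul]
  refine norm_integral_le_of_norm_le
    ((integrableOn_Ioi_rpow_of_lt (by linarith) one_pos).const_mul _) ?_
  refine (ae_restrict_iff' measurableSet_Ioi).2 (ae_of_all _ fun y hy => ?_)
  have hy0 : 0 < y := zero_lt_one.trans hy
  have h := hK (X * y)⁻¹ (by positivity)
  rw [Real.inv_rpow (by positivity), Real.rpow_neg (by positivity), inv_inv,
    Real.mul_rpow hX.le hy0.le] at h
  rw [hφ, norm_mul, norm_cpow_eq_rpow_re_of_pos hy0]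
  calc y ^ (-w - 1).re * ‖g (X * y)⁻¹‖ ≤ y ^ (-w - 1).re * (K * (X ^ a * y ^ a)) := by gcongr
    _ = K * X ^ a * y ^ (a - w.re - 1) := by
      rw [show a - w.re - 1 = (-w - 1).re + a by simp; ring, Real.rpow_add hy0]
      ring

/-- Shifting the line of integration to `a` bounds the holomorphic part by `X ^ a`. -/
theorem exists_norm_integral_mul_mellin_mul_cpow_le (hg : IsMellinTest g) {a b C B : ℝ}
    (hab : a ≤ b) (hC : 0 ≤ C) {G : ℂ → ℂ} (hGd : DifferentiableOn ℂ G (re ⁻¹' Icc a b))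
    (hG : ∀ σ ∈ Icc a b, ∀ t : ℝ, ‖G (σ + t * I)‖ ≤ C * (1 + |t|) ^ B) :
    ∃ K : ℝ, ∀ X : ℝ, 0 < X →
      ‖∫ t : ℝ, G (b + t * I) * mellin g (b + t * I) * (X : ℂ) ^ ((b : ℂ) + t * I)‖ ≤
        K * X ^ a := by
  obtain ⟨K, hK⟩ := hg.exists_norm_mul_mellin_le hC hG
  refine ⟨K * ∫ t : ℝ, (1 + t ^ 2)⁻¹, fun X hX => ?_⟩
  have hbd (σ : ℝ) (hσ : σ ∈ Icc a b) (t : ℝ) :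
      ‖G (σ + t * I) * mellin g (σ + t * I) * (X : ℂ) ^ ((σ : ℂ) + t * I)‖ ≤
        K * X ^ σ * (1 + t ^ 2)⁻¹ := by
    rw [norm_mul, norm_ofReal_cpow_line hX, mul_right_comm]
    exact mul_le_mul_of_nonneg_right (hK σ hσ t) (by positivity)
  have hK0 : 0 ≤ K := by
    simpa using (norm_nonneg _).trans (hK a (left_mem_Icc.2 hab) 0)
  have hshift := integral_vertical_line_eq_of_norm_le
    (H := fun s => G s * mellin g s * (X : ℂ) ^ s) (K := K * (X ^ a + X ^ b)) hab ?_ ?_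
  · rw [hshift, mul_right_comm, ← integral_const_mul]
    exact norm_integral_le_of_norm_le (integrable_inv_one_add_sq.const_mul _)
      (ae_of_all _ (hbd a (left_mem_Icc.2 hab)))
  · exact (hGd.mul hg.differentiable_mellin.differentiableOn).mul fun s _ =>
      (differentiableAt_id.const_cpow (Or.inl (ofReal_ne_zero.2 hX.ne'))).differentiableWithinAt
  · refine fun σ hσ t => (hbd σ hσ t).trans ?_
    gcongr
    have ha := Real.rpow_nonneg hX.le a
    have hb := Real.rpow_nonneg hX.le b
    rcases le_total X 1 with h | h
    · linarith [Real.rpow_le_rpow_of_exponent_ge hX h hσ.1]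
    · linarith [Real.rpow_le_rpow_of_exponent_le h hσ.2]

end IsMellinTest

theorem IsMellinTest.integrable_div_sub_mul_mellin_mul_cpow {g : ℝ → ℂ} (hg : IsMellinTest g)
    {σ X : ℝ} {w : ℂ} (hw : w.re < σ) (hX : 0 < X) :
    Integrable fun t : ℝ =>
      1 / ((σ : ℂ) + t * I - w) * mellin g (σ + t * I) * (X : ℂ) ^ ((σ : ℂ) + t * I) := by
  have hre (t : ℝ) : ((σ : ℂ) + t * I - w).re = σ - w.re := by simp
  have hne (t : ℝ) : (σ : ℂ) + t * I - w ≠ 0 := fun h => by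
    have := hre t
    rw [h, zero_re] at this
    linarith
  refine hg.integrable_mul_mellin_mul_cpow (G := fun z => 1 / (z - w)) (C := 1 / (σ - w.re))
    (B := 0) hX (by simpa using hw.le) ?_ fun t => ?_
  · exact continuous_const.div (by fun_prop) hne
  · rw [norm_div, norm_one, Real.rpow_zero, mul_one]
    refine one_div_le_one_div_of_le (sub_pos.2 hw) ?_
    rw [← hre t]
    exact re_le_norm _

theorem stmt_11 (c' c'' c : ℝ) (h1 : c' < c'') (h2 : c'' < c)
    (G : ℂ → ℂ) (hG : AnalyticOnNhd ℂ G {w : ℂ | c' < w.re})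
    (C B : ℝ) (hC : 0 < C) (hB : 0 < B)
    (hbound : ∀ σ t : ℝ, σ ∈ Set.Icc c'' c →
      ‖G ((σ : ℂ) + (t : ℂ) * Complex.I)‖ ≤ C * (1 + |t|) ^ B)
    (m : ℕ) (w : Fin m → ℂ) (hwinj : Function.Injective w)
    (hw : ∀ j, c'' < (w j).re ∧ (w j).re < c)
    (r : Fin m → ℂ)
    (F : ℂ → ℂ) (hF : ∀ z : ℂ, F z = G z + ∑ j, r j / (z - w j))
    (g : ℝ → ℂ) (hg : ContDiff ℝ (⊤ : ℕ∞) g) (hgsupp : HasCompactSupport g)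
    (hgpos : tsupport g ⊆ Set.Ioi 0) :
    ∃ C₁ : ℝ, ∀ X : ℝ, 1 ≤ X →
      Integrable (fun t : ℝ =>
        F ((c : ℂ) + (t : ℂ) * Complex.I) * mellin g ((c : ℂ) + (t : ℂ) * Complex.I) *
          (X : ℂ) ^ ((c : ℂ) + (t : ℂ) * Complex.I)) ∧
      ‖(1 / (2 * (Real.pi : ℂ))) * (∫ t : ℝ,
          F ((c : ℂ) + (t : ℂ) * Complex.I) * mellin g ((c : ℂ) + (t : ℂ) * Complex.I) *
            (X : ℂ) ^ ((c : ℂ) + (t : ℂ) * Complex.I)) -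
        ∑ j, r j * mellin g (w j) * (X : ℂ) ^ (w j)‖ ≤ C₁ * X ^ c'' := by
  have hT : IsMellinTest g := ⟨hg, hgsupp, hgpos⟩
  have hGd : DifferentiableOn ℂ G (re ⁻¹' Icc c'' c) := fun z hz =>
    (hG z (h1.trans_le hz.1)).differentiableAt.differentiableWithinAt
  have hbd : ∀ σ ∈ Icc c'' c, ∀ t : ℝ, ‖G (σ + t * I)‖ ≤ C * (1 + |t|) ^ B :=
    fun σ hσ t => hbound σ t hσ
  have hc : c ∈ Icc c'' c := right_mem_Icc.2 h2.le
  obtain ⟨K, hK⟩ := hT.exists_norm_integral_mul_mellin_mul_cpow_le h2.le hC.le hGd hbd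
  choose L hL using fun j => hT.exists_norm_integral_div_sub_sub_le (hw j).1 (hw j).2
  refine ⟨‖1 / (2 * (Real.pi : ℂ))‖ * K + ∑ j, ‖r j‖ * L j, fun X hX => ?_⟩
  have hX0 : 0 < X := zero_lt_one.trans_le hX
  have hGi := hT.integrable_mul_mellin_mul_cpow (σ := c) hX0 hC.le
    (hGd.continuousOn.comp_continuous (by fun_prop) fun t => by simpa using hc) (hbd c hc)
  have hPi (j : Fin m) :=
    (hT.integrable_div_sub_mul_mellin_mul_cpow (hw j).2 hX0).const_mul (r j)
  have hSi := integrable_finsetSum Finset.univ fun j _ => hPi j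
  have hsplit (t : ℝ) : F ((c : ℂ) + t * I) * mellin g (c + t * I) * (X : ℂ) ^ ((c : ℂ) + t * I) =
      G (c + t * I) * mellin g (c + t * I) * (X : ℂ) ^ ((c : ℂ) + t * I) +
      ∑ j, r j * (1 / ((c : ℂ) + t * I - w j) * mellin g (c + t * I) *
        (X : ℂ) ^ ((c : ℂ) + t * I)) := by
    rw [hF, add_mul, add_mul, Finset.sum_mul, Finset.sum_mul]
    congr 1
    refine Finset.sum_congr rfl fun j _ => ?_
    ring
  simp only [hsplit]
  refine ⟨hGi.add hSi, ?_⟩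
  rw [integral_add hGi hSi, integral_finsetSum _ fun j _ => hPi j, mul_add, add_sub_assoc,
    Finset.mul_sum, ← Finset.sum_sub_distrib, add_mul, Finset.sum_mul]
  refine norm_add_le_of_le ?_ (norm_sum_le_of_le _ fun j _ => ?_)
  · rw [norm_mul, mul_assoc]
    gcongr
    exact hK X hX0
  · rw [integral_const_mul, mul_left_comm, mul_assoc (r j), ← mul_sub, norm_mul, mul_assoc]
    gcongr
    exact hL j X hX0
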